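/- Let m < M be real numbers and let A ∈ B(H) be self-adjoint with Λ(A) ⊆ [m, M]. Let f be a continuous real function on [m, M] and let p_L, p_U be real polynomials with 0 < p_L(x) ≤ f(x) ≤ p_U(x) for all x ∈ [m, M]. Put μ_U = min Λ(p_U(A)), ν_U = max Λ(p_U(A)), μ_L = min Λ(p_L(A)), ν_L = max Λ(p_L(A)), and assume μ_U < ν_U and μ_L < ν_L. Then Φ(f(A)) ≥ V*( Σ_{i : a_i ≥ 0} a_i · K(μ_L, ν_L, i)^{−1} · p_L(A)^i + Σ_{i : a_i < 0} a_i · K(μ_U, ν_U, i) · p_U(A)^i ) V in the Loewner order. -/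

import Mathlib

open ContinuousLinearMap in
/-- The Kantorovich constant `K(m', M', r)`, with the convention that it equals `1`
for `r = 0` and `r = 1`. -/
noncomputable def kantorovich (m M r : ℝ) : ℝ :=
  if r = 0 ∨ r = 1 then 1 else
    ((m * M ^ r - M * m ^ r) / ((r - 1) * (M - m))) *
      (((r - 1) * (M ^ r - m ^ r)) / (r * (m * M ^ r - M * m ^ r))) ^ r

open ContinuousLinearMap Polynomial

theorem one_le_kantorovich_natCast {m M : ℝ} (hm : 0 < m) (hmM : m < M) (n : ℕ) :
    1 ≤ kantorovich m M n := by
  unfold kantorovich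
  split_ifs with h
  · exact le_rfl
  · push Not at h
    have hn0 : n ≠ 0 := by exact_mod_cast h.1
    have hn1 : n ≠ 1 := by exact_mod_cast h.2
    obtain ⟨k, rfl⟩ : ∃ k, n = k + 2 := ⟨n - 2, by omega⟩
    simp only [Real.rpow_natCast]
    set n := k + 2 with hn
    have hnR : (1 : ℝ) < n := by exact_mod_cast (by omega : 1 < n)
    have hM : 0 < M := hm.trans hmM
    have hP : 0 < M ^ n - m ^ n := sub_pos.2 (pow_lt_pow_left₀ hmM hm.le hn0)
    have hQ : 0 < m * M ^ n - M * m ^ n := by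
      have h1 : m ^ (k + 1) < M ^ (k + 1) := pow_lt_pow_left₀ hmM hm.le k.succ_ne_zero
      have h2 : m * M ^ n - M * m ^ n = m * M * (M ^ (k + 1) - m ^ (k + 1)) := by
        rw [hn]; ring
      rw [h2]
      exact mul_pos (mul_pos hm hM) (sub_pos.2 h1)
    have hD : 0 < M - m := sub_pos.2 hmM
    have hn1' : (0 : ℝ) < n - 1 := sub_pos.2 hnR
    have hn0' : (0 : ℝ) < n := by linarith
    set P := M ^ n - m ^ n with hPdef
    set Q := m * M ^ n - M * m ^ n with hQdef
    set t := (n - 1) * P / (n * Q) with ht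
    have ht0 : 0 < t := by positivity
    have hbern : 1 + n * (t * m - 1) ≤ (t * m) ^ n := by
      have hb := one_add_mul_le_pow (a := t * m - 1) (by nlinarith [mul_pos ht0 hm]) n
      simpa using hb
    have hc : 0 < Q / ((n - 1) * (M - m)) := by positivity
    have key := mul_le_mul_of_nonneg_left hbern hc.le
    have hlhs : Q / ((n - 1) * (M - m)) * (1 + n * (t * m - 1)) = m ^ n := by
      have h1 : Q / ((n - 1) * (M - m)) * (1 + n * (t * m - 1)) = (m * P - Q) / (M - m) := by
        rw [ht]; field_simp; ring
      rw [h1, div_eq_iff hD.ne', hPdef, hQdef]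
      ring
    rw [hlhs, mul_pow, ← mul_assoc] at key
    exact le_of_mul_le_mul_right (by simpa using key) (pow_pos hm n)

/-- The infimum of the spectrum of a positive function of `A` is positive, as soon as the spectrum
is not a subsingleton. -/
theorem sInf_spectrum_cfc_pos {R : Type*} [CStarAlgebra R] {A : R} (hA : IsSelfAdjoint A)
    {g : ℝ → ℝ} (hg : ContinuousOn g (spectrum ℝ A)) (hpos : ∀ x ∈ spectrum ℝ A, 0 < g x)
    (hlt : sInf (spectrum ℝ (cfc g A)) < sSup (spectrum ℝ (cfc g A))) :
    0 < sInf (spectrum ℝ (cfc g A)) := by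
  have hne : (spectrum ℝ (cfc g A)).Nonempty := by
    by_contra h
    simp [Set.not_nonempty_iff_eq_empty.1 h] at hlt
  have hmem := (spectrum.isCompact (𝕜 := ℝ) (cfc g A)).sInf_mem hne
  rw [cfc_map_spectrum g A] at hmem ⊢
  obtain ⟨x, hx, hgx⟩ := hmem
  exact hgx ▸ hpos x hx

theorem cfc_pow_le_cfc_pow {R : Type*} [CStarAlgebra R] [PartialOrder R] [StarOrderedRing R]
    {A : R} (hA : IsSelfAdjoint A) {g h : ℝ → ℝ} (hg : ContinuousOn g (spectrum ℝ A))
    (hh : ContinuousOn h (spectrum ℝ A)) (hpos : ∀ x ∈ spectrum ℝ A, 0 ≤ g x)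
    (hle : ∀ x ∈ spectrum ℝ A, g x ≤ h x) (n : ℕ) :
    cfc g A ^ n ≤ cfc h A ^ n := by
  rw [← cfc_pow g n A, ← cfc_pow h n A]
  exact cfc_mono fun x hx => pow_le_pow_left₀ (hpos x hx) (hle x hx) n

theorem cfc_pow_nonneg {R : Type*} [CStarAlgebra R] [PartialOrder R] [StarOrderedRing R]
    {A : R} (hA : IsSelfAdjoint A) {g : ℝ → ℝ} (hg : ContinuousOn g (spectrum ℝ A))
    (hpos : ∀ x ∈ spectrum ℝ A, 0 ≤ g x) (n : ℕ) :
    0 ≤ cfc g A ^ n := by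
  rw [← cfc_pow g n A]
  exact cfc_nonneg fun x hx => pow_nonneg (hpos x hx) n

/-- Compression by a bounded operator preserves the Loewner order. -/
theorem adjoint_comp_comp_mono {H K : Type*}
    [NormedAddCommGroup H] [InnerProductSpace ℂ H] [CompleteSpace H]
    [NormedAddCommGroup K] [InnerProductSpace ℂ K] [CompleteSpace K]
    (V : K →L[ℂ] H) {S T : H →L[ℂ] H} (h : S ≤ T) :
    (adjoint V) ∘L S ∘L V ≤ (adjoint V) ∘L T ∘L V := by
  rw [ContinuousLinearMap.le_def] at h ⊢
  simpa [ContinuousLinearMap.comp_sub, ContinuousLinearMap.sub_comp] using h.adjoint_conj V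

theorem stmt1
    {H K : Type*} [NormedAddCommGroup H] [InnerProductSpace ℂ H] [CompleteSpace H]
    [NormedAddCommGroup K] [InnerProductSpace ℂ K] [CompleteSpace K]
    (V : K →L[ℂ] H) (hV : (adjoint V) ∘L V = 1)
    (I : ℕ) (a : ℕ → ℝ)
    (m M : ℝ) (hmM : m < M)
    (A : H →L[ℂ] H) (hA : IsSelfAdjoint A) (hspec : spectrum ℝ A ⊆ Set.Icc m M)
    (f : ℝ → ℝ) (hf : ContinuousOn f (Set.Icc m M))
    (pL pU : Polynomial ℝ)
    (hp : ∀ x ∈ Set.Icc m M, 0 < pL.eval x ∧ pL.eval x ≤ f x ∧ f x ≤ pU.eval x)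
    (μU νU μL νL : ℝ)
    (hμU : μU = sInf (spectrum ℝ (cfc (fun x => pU.eval x) A)))
    (hνU : νU = sSup (spectrum ℝ (cfc (fun x => pU.eval x) A)))
    (hμL : μL = sInf (spectrum ℝ (cfc (fun x => pL.eval x) A)))
    (hνL : νL = sSup (spectrum ℝ (cfc (fun x => pL.eval x) A)))
    (hU : μU < νU) (hL : μL < νL) :
    (adjoint V) ∘L
      ((∑ i ∈ (Finset.range (I + 1)).filter (fun i => 0 ≤ a i),
          (a i * (kantorovich μL νL (i : ℝ))⁻¹) • (cfc (fun x => pL.eval x) A) ^ i) +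
        ∑ i ∈ (Finset.range (I + 1)).filter (fun i => a i < 0),
          (a i * kantorovich μU νU (i : ℝ)) • (cfc (fun x => pU.eval x) A) ^ i) ∘L V ≤
    (adjoint V) ∘L (∑ i ∈ Finset.range (I + 1), a i • (cfc f A) ^ i) ∘L V := by
  have cL : ContinuousOn (fun x => pL.eval x) (spectrum ℝ A) := pL.continuous.continuousOn
  have cU : ContinuousOn (fun x => pU.eval x) (spectrum ℝ A) := pU.continuous.continuousOn
  have cf : ContinuousOn f (spectrum ℝ A) := hf.mono hspec
  have pos_L : ∀ x ∈ spectrum ℝ A, 0 < pL.eval x := fun x hx => (hp x (hspec hx)).1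
  have L_le : ∀ x ∈ spectrum ℝ A, pL.eval x ≤ f x := fun x hx => (hp x (hspec hx)).2.1
  have le_U : ∀ x ∈ spectrum ℝ A, f x ≤ pU.eval x := fun x hx => (hp x (hspec hx)).2.2
  have pos_f : ∀ x ∈ spectrum ℝ A, 0 < f x := fun x hx => (pos_L x hx).trans_le (L_le x hx)
  have pos_U : ∀ x ∈ spectrum ℝ A, 0 < pU.eval x := fun x hx => (pos_f x hx).trans_le (le_U x hx)
  have hμL0 : 0 < μL := hμL ▸ sInf_spectrum_cfc_pos hA cL pos_L (hμL ▸ hνL ▸ hL)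
  have hμU0 : 0 < μU := hμU ▸ sInf_spectrum_cfc_pos hA cU pos_U (hμU ▸ hνU ▸ hU)
  refine adjoint_comp_comp_mono V ?_
  rw [← Finset.sum_filter_add_sum_filter_not (Finset.range (I + 1)) (fun i => 0 ≤ a i)
    (fun i => a i • cfc f A ^ i)]
  simp only [not_le]
  refine add_le_add (Finset.sum_le_sum fun i hi => ?_) (Finset.sum_le_sum fun i hi => ?_)
  · have hai : 0 ≤ a i := (Finset.mem_filter.1 hi).2
    calc _ ≤ a i • cfc (fun x => pL.eval x) A ^ i :=
          smul_le_smul_of_nonneg_right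
            (mul_le_of_le_one_right hai
              (inv_le_one_of_one_le₀ (one_le_kantorovich_natCast hμL0 hL i)))
            (cfc_pow_nonneg hA cL (fun x hx => (pos_L x hx).le) i)
      _ ≤ _ := smul_le_smul_of_nonneg_left
          (cfc_pow_le_cfc_pow hA cL cf (fun x hx => (pos_L x hx).le) L_le i) hai
  · have hai : a i ≤ 0 := (Finset.mem_filter.1 hi).2.le
    calc _ ≤ a i • cfc (fun x => pU.eval x) A ^ i :=
          smul_le_smul_of_nonneg_right
            (mul_le_of_one_le_right hai (one_le_kantorovich_natCast hμU0 hU i))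
            (cfc_pow_nonneg hA cU (fun x hx => (pos_U x hx).le) i)
      _ ≤ _ := smul_le_smul_of_nonpos_left
          (cfc_pow_le_cfc_pow hA cf cU (fun x hx => (pos_f x hx).le) le_U i) hai
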